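/- For every integer k ≥ 1, the integer n_k = L_{8k} + L_{6k} + L_{4k} + L_{2k} − 1 satisfies the identity n_k³ = L_{24k} + 3L_{22k} + 6L_{20k} + 10L_{18k} + 9L_{16k} + 9L_{14k} + 10L_{12k} + 12L_{10k} + 27L_{8k} + 28L_{6k} + 27L_{4k} + 24L_{2k} + 11. -/

import Mathlib

/-- Zeckendorf sum of digits: number of summands in the Zeckendorf
representation of `n` (equivalently, minimal number of Fibonacci numbers
needed to write `n` as a sum of Fibonacci numbers). -/
def sF (n : ℕ) : ℕ := (Nat.zeckendorf n).length

/-- Lucas numbers: `L 0 = 2`, `L k = F (k-1) + F (k+1)` for `k ≥ 1`. -/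
def lucas : ℕ → ℕ
  | 0 => 2
  | k + 1 => Nat.fib k + Nat.fib (k + 2)

theorem lucas_add_two (n : ℕ) : lucas (n + 2) = lucas n + lucas (n + 1) := by
  cases n with
  | zero => simp [lucas, Nat.fib_add_two]
  | succ m =>
    simp only [lucas, Nat.fib_add_two]
    ring

theorem coe_lucas_eq (n : ℕ) :
    (lucas n : ℝ) = Real.goldenRatio ^ n + Real.goldenConj ^ n := by
  induction n using Nat.twoStepInduction with
  | zero => norm_num [lucas]
  | one => simp [lucas]
  | more n ih ih' =>
    rw [lucas_add_two, Nat.cast_add, ih, ih', pow_add _ n 2, pow_add _ n 2,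
      Real.goldenRatio_sq, Real.goldenConj_sq]
    ring

theorem lucas_pos (n : ℕ) : 0 < lucas n := by
  cases n with
  | zero => simp [lucas]
  | succ m =>
    have : 0 < Nat.fib (m + 2) := Nat.fib_pos.2 (Nat.succ_pos (m + 1))
    simp only [lucas]
    omega

/-- Even-indexed Lucas numbers in terms of a real number and its inverse. -/
theorem coe_lucas_two_mul_mul (j k : ℕ) :
    (lucas (2 * j * k) : ℝ) =
      (Real.goldenRatio ^ (2 * k)) ^ j + ((Real.goldenRatio ^ (2 * k))⁻¹) ^ j := by
  have h : Real.goldenConj ^ (2 * k) = (Real.goldenRatio ^ (2 * k))⁻¹ := by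
    rw [← inv_pow, Real.inv_goldenRatio, Even.neg_pow (even_two_mul k)]
  rw [coe_lucas_eq, ← h, ← pow_mul, ← pow_mul, show 2 * j * k = 2 * k * j by ring]

theorem stmt_18 (k : ℕ) (hk : 1 ≤ k) :
    (lucas (8 * k) + lucas (6 * k) + lucas (4 * k) + lucas (2 * k) - 1) ^ 3 =
      lucas (24 * k) + 3 * lucas (22 * k) + 6 * lucas (20 * k) + 10 * lucas (18 * k) +
        9 * lucas (16 * k) + 9 * lucas (14 * k) + 10 * lucas (12 * k) + 12 * lucas (10 * k) +
        27 * lucas (8 * k) + 28 * lucas (6 * k) + 27 * lucas (4 * k) + 24 * lucas (2 * k) +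
        11 := by
  have h1 : 1 ≤ lucas (8 * k) + lucas (6 * k) + lucas (4 * k) + lucas (2 * k) := by
    have := lucas_pos (2 * k)
    omega
  have hy : Real.goldenRatio ^ (2 * k) ≠ 0 := pow_ne_zero _ Real.goldenRatio_ne_zero
  have h := fun j => coe_lucas_two_mul_mul j k
  generalize Real.goldenRatio ^ (2 * k) = y at hy h
  rw [← Nat.cast_inj (R := ℝ)]
  push_cast [Nat.cast_sub h1]
  rw [h 1, h 2, h 3, h 4, h 5, h 6, h 7, h 8, h 9, h 10, h 11, h 12]
  field_simp
  ring
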